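/- Assume Ω satisfies the p-Sobolev–Poincaré inequality with constant C₀ for some p with 1 ≤ p ≤ n/(n−1). Then there is a constant C depending only on p and C₀ such that for every f ∈ W(Ω) and every median r_f of f, the nonincreasing function (f − r_f)* is differentiable almost everywhere on (0,1) and for every t ∈ (0,1): ∫₀^t s^{1/p} (−((f − r_f)*)'(s)) ds ≤ C ∫₀^t |∇f|*(s) ds. -/

import Mathlib

open MeasureTheory Set
open scoped ENNReal NNReal

noncomputable section

/-- The decreasing rearrangement of `u` with respect to the measure `μ`:
`u*(t) = inf { λ ≥ 0 : μ{|u| > λ} ≤ t }`. -/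
def decRearr {α : Type*} [MeasurableSpace α] (μ : Measure α) (u : α → ℝ) (t : ℝ) : ℝ :=
  sInf {l : ℝ | 0 ≤ l ∧ μ {x | l < |u x|} ≤ ENNReal.ofReal t}

/-- `u**(t) = (1/t) ∫₀ᵗ u*(s) ds`. -/
def decRearrAvg {α : Type*} [MeasurableSpace α] (μ : Measure α) (u : α → ℝ) (t : ℝ) : ℝ :=
  (1 / t) * ∫ s in Ioc (0 : ℝ) t, decRearr μ u s

abbrev Euc (n : ℕ) := EuclideanSpace ℝ (Fin n)

/-- `|∇f|(x)`, using the a.e. defined differential (Rademacher's theorem for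
locally Lipschitz functions). -/
def gradNorm {n : ℕ} (f : Euc n → ℝ) (x : Euc n) : ℝ := ‖fderiv ℝ f x‖

/-- The admissible class `W(Ω)`: locally Lipschitz on `Ω`, with `f` and `|∇f|`
integrable on `Ω`. -/
def MemW {n : ℕ} (Ω : Set (Euc n)) (f : Euc n → ℝ) : Prop :=
  (∀ x ∈ Ω, ∃ s ∈ nhds x, ∃ K : ℝ≥0, LipschitzOnWith K f s) ∧
    IntegrableOn f Ω ∧ IntegrableOn (gradNorm f) Ω

/-- `Ω` satisfies the `p`-Sobolev–Poincaré inequality with constant `C₀`. -/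
def SPIneq {n : ℕ} (Ω : Set (Euc n)) (p C₀ : ℝ) : Prop :=
  ∀ f : Euc n → ℝ, MemW Ω f →
    (∫ x in Ω, |f x - ∫ y in Ω, f y| ^ p) ^ (1 / p) ≤ C₀ * ∫ x in Ω, gradNorm f x

/-- `r` is a median of `f` on `Ω` (with `|Ω| = 1`). -/
def IsMedian {n : ℕ} (Ω : Set (Euc n)) (f : Euc n → ℝ) (r : ℝ) : Prop :=
  1 / 2 ≤ volume {x ∈ Ω | r ≤ f x} ∧ 1 / 2 ≤ volume {x ∈ Ω | f x ≤ r}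

open Filter Topology

lemma decRearr_nonneg {α : Type*} [MeasurableSpace α] (μ : Measure α) (u : α → ℝ) (t : ℝ) :
    0 ≤ decRearr μ u t := Real.sInf_nonneg fun _ h => h.1

lemma decRearr_bdd {α : Type*} [MeasurableSpace α] (μ : Measure α) (u : α → ℝ) (t : ℝ) :
    BddBelow {l : ℝ | 0 ≤ l ∧ μ {x | l < |u x|} ≤ ENNReal.ofReal t} := ⟨0, fun _ h => h.1⟩

lemma decRearr_nonempty {α : Type*} [MeasurableSpace α] (μ : Measure α) [IsFiniteMeasure μ]
    {u : α → ℝ} (hu : AEMeasurable u μ) {t : ℝ} (ht : 0 < t) :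
    {l : ℝ | 0 ≤ l ∧ μ {x | l < |u x|} ≤ ENNReal.ofReal t}.Nonempty := by
  have h := tendsto_measure_iInter_atTop (μ := μ) (s := fun n : ℕ => {x | (n : ℝ) < |u x|})
    (fun n => nullMeasurableSet_lt aemeasurable_const (by fun_prop))
    (fun m n hmn x hx => by
      have : (m : ℝ) ≤ n := by exact_mod_cast hmn
      exact lt_of_le_of_lt this hx) ⟨0, measure_ne_top _ _⟩
  have he : (⋂ n : ℕ, {x | (n : ℝ) < |u x|}) = ∅ := by
    ext x
    simp only [mem_iInter, mem_ofPred_eq, mem_empty_iff_false, iff_false, not_forall, not_lt]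
    exact exists_nat_ge _
  rw [he, measure_empty] at h
  have h2 := h.eventually (ge_mem_nhds (ENNReal.ofReal_pos.2 ht))
  obtain ⟨n, hn⟩ := h2.exists
  exact ⟨n, Nat.cast_nonneg n, hn⟩

lemma decRearr_le_iff {α : Type*} [MeasurableSpace α] (μ : Measure α) [IsFiniteMeasure μ]
    {u : α → ℝ} (hu : AEMeasurable u μ) {t : ℝ} (ht : 0 < t) {l : ℝ} (hl : 0 ≤ l) :
    decRearr μ u t ≤ l ↔ μ {x | l < |u x|} ≤ ENNReal.ofReal t := by
  constructor
  · intro h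
    have hU : {x | l < |u x|} = ⋃ n : ℕ, {x | l + 1 / ((n : ℝ) + 1) < |u x|} := by
      ext x
      simp only [mem_iUnion, mem_ofPred_eq]
      constructor
      · intro hx
        obtain ⟨n, hn⟩ := exists_nat_one_div_lt (sub_pos.2 hx)
        exact ⟨n, by linarith⟩
      · rintro ⟨n, hn⟩
        have : (0 : ℝ) < 1 / ((n : ℝ) + 1) := by positivity
        linarith
    have hmono : Monotone fun n : ℕ => {x | l + 1 / ((n : ℝ) + 1) < |u x|} := by
      intro m n hmn x hx
      have : (1 : ℝ) / ((n : ℝ) + 1) ≤ 1 / ((m : ℝ) + 1) := Nat.one_div_le_one_div hmn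
      simp only [mem_ofPred_eq] at hx ⊢
      linarith
    rw [hU, hmono.measure_iUnion]
    refine iSup_le fun n => ?_
    have hpos : (0 : ℝ) < 1 / ((n : ℝ) + 1) := by positivity
    have hlt : decRearr μ u t < l + 1 / ((n : ℝ) + 1) := by linarith
    obtain ⟨k, hk, hkl⟩ := exists_lt_of_csInf_lt (decRearr_nonempty μ hu ht) hlt
    exact le_trans (measure_mono fun x hx => hkl.trans hx) hk.2
  · intro h
    exact csInf_le (decRearr_bdd μ u t) ⟨hl, h⟩

lemma decRearr_anti {α : Type*} [MeasurableSpace α] (μ : Measure α) [IsFiniteMeasure μ]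
    {u : α → ℝ} (hu : AEMeasurable u μ) : AntitoneOn (decRearr μ u) (Ioi 0) := by
  intro s hs t ht hst
  rw [decRearr_le_iff μ hu ht (decRearr_nonneg _ _ _)]
  exact ((decRearr_le_iff μ hu hs (decRearr_nonneg _ _ _)).1 le_rfl).trans
    (ENNReal.ofReal_le_ofReal hst)

lemma meas_gt_decRearr {α : Type*} [MeasurableSpace α] (μ : Measure α) [IsFiniteMeasure μ]
    {u : α → ℝ} (hu : AEMeasurable u μ) {t : ℝ} (ht : 0 < t) :
    μ {x | decRearr μ u t < |u x|} ≤ ENNReal.ofReal t :=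
  (decRearr_le_iff μ hu ht (decRearr_nonneg _ _ _)).1 le_rfl

lemma meas_ge_decRearr {α : Type*} [MeasurableSpace α] (μ : Measure α) [IsFiniteMeasure μ]
    {u : α → ℝ} (hu : AEMeasurable u μ) {t : ℝ} (ht : 0 < t) (hpos : 0 < decRearr μ u t) :
    ENNReal.ofReal t ≤ μ {x | decRearr μ u t ≤ |u x|} := by
  set b := decRearr μ u t with hb
  have h := tendsto_measure_iInter_atTop (μ := μ)
    (s := fun n : ℕ => {x | b - b / ((n : ℝ) + 1) < |u x|})
    (fun n => nullMeasurableSet_lt aemeasurable_const (by fun_prop))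
    (fun m n hmn x hx => by
      have : b / ((n : ℝ) + 1) ≤ b / ((m : ℝ) + 1) := by gcongr
      simp only [mem_ofPred_eq] at hx ⊢
      linarith) ⟨0, measure_ne_top _ _⟩
  have he : (⋂ n : ℕ, {x | b - b / ((n : ℝ) + 1) < |u x|}) = {x | b ≤ |u x|} := by
    ext x
    simp only [mem_iInter, mem_ofPred_eq]
    constructor
    · intro hx
      by_contra! hlt
      obtain ⟨n, hn⟩ := exists_nat_one_div_lt (div_pos (sub_pos.2 hlt) hpos)
      have h1 := hx n
      rw [lt_div_iff₀ hpos] at hn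
      have h2 : 1 / ((n : ℝ) + 1) * b = b / ((n : ℝ) + 1) := by ring
      linarith
    · intro hx n
      have : 0 < b / ((n : ℝ) + 1) := by positivity
      linarith
  rw [he] at h
  refine ge_of_tendsto' h fun n => ?_
  have h0 : 0 < b / ((n : ℝ) + 1) := by positivity
  have h1 : b / ((n : ℝ) + 1) ≤ b := div_le_self hpos.le (by
    have : (0 : ℝ) ≤ n := Nat.cast_nonneg n
    linarith)
  have h3 := (decRearr_le_iff μ hu ht (l := b - b / ((n : ℝ) + 1)) (by linarith)).not.1
    (by rw [← hb]; linarith)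
  exact (not_le.1 h3).le

lemma lintegral_decRearr_le {α : Type*} [MeasurableSpace α] (μ : Measure α) [IsFiniteMeasure μ]
    {u : α → ℝ} (hu : AEMeasurable u μ) (t : ℝ) :
    ∫⁻ s in Ioc 0 t, ENNReal.ofReal (decRearr μ u s) ≤ ∫⁻ x, ENNReal.ofReal |u x| ∂μ := by
  have hm : AEMeasurable (decRearr μ u) (volume.restrict (Ioc 0 t)) :=
    aemeasurable_restrict_of_antitoneOn measurableSet_Ioc
      ((decRearr_anti μ hu).mono Ioc_subset_Ioi_self)
  rw [lintegral_eq_lintegral_meas_lt _ (ae_of_all _ fun s => decRearr_nonneg μ u s) hm,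
    lintegral_eq_lintegral_meas_lt μ (ae_of_all _ fun s => abs_nonneg _) (by fun_prop)]
  refine setLIntegral_mono' measurableSet_Ioi fun l hl => ?_
  rw [Measure.restrict_apply' measurableSet_Ioc]
  have : {a | l < decRearr μ u a} ∩ Ioc 0 t ⊆ Ioc 0 (μ {x | l < |u x|}).toReal := by
    rintro s ⟨hs, hst⟩
    refine ⟨hst.1, ?_⟩
    have h3 := (decRearr_le_iff μ hu hst.1 (le_of_lt hl)).not.1 (not_le.2 hs)
    exact ((ENNReal.lt_ofReal_iff_toReal_lt (measure_ne_top _ _)).not.1 (fun h => h3 h.le) |> not_lt.1)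
  refine (measure_mono this).trans ?_
  rw [Real.volume_Ioc, sub_zero, ENNReal.ofReal_toReal (measure_ne_top _ _)]

lemma decRearr_integrableOn {α : Type*} [MeasurableSpace α] (μ : Measure α) [IsFiniteMeasure μ]
    {u : α → ℝ} (hu : Integrable u μ) (t : ℝ) :
    IntegrableOn (decRearr μ u) (Ioc 0 t) := by
  have hm : AEMeasurable (decRearr μ u) (volume.restrict (Ioc 0 t)) :=
    aemeasurable_restrict_of_antitoneOn measurableSet_Ioc
      ((decRearr_anti μ hu.1.aemeasurable).mono Ioc_subset_Ioi_self)
  refine ⟨hm.aestronglyMeasurable, ?_⟩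
  rw [hasFiniteIntegral_iff_ofReal (ae_of_all _ fun s => decRearr_nonneg μ u s)]
  refine (lintegral_decRearr_le μ hu.1.aemeasurable t).trans_lt ?_
  exact (hasFiniteIntegral_iff_ofReal (ae_of_all _ fun s => abs_nonneg _)).1 hu.abs.2

lemma hardy_littlewood {α : Type*} [MeasurableSpace α] (μ : Measure α) [IsFiniteMeasure μ]
    {u : α → ℝ} (hu : Integrable u μ) (hu0 : ∀ x, 0 ≤ u x) {t : ℝ} {E : Set α}
    (hE : μ E ≤ ENNReal.ofReal t) :
    ∫ x in E, u x ∂μ ≤ ∫ s in Ioc 0 t, decRearr μ u s := by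
  have hi := decRearr_integrableOn μ hu t
  have hum := hu.1.aemeasurable
  rw [integral_eq_lintegral_of_nonneg_ae (ae_of_all _ hu0) hu.1.restrict,
    integral_eq_lintegral_of_nonneg_ae (ae_of_all _ fun s => decRearr_nonneg μ u s) hi.1]
  refine ENNReal.toReal_mono ?_ ?_
  · exact ((hasFiniteIntegral_iff_ofReal
      (ae_of_all _ fun s => decRearr_nonneg μ u s)).1 hi.2).ne
  rw [lintegral_eq_lintegral_meas_lt _ (ae_of_all _ fun s => decRearr_nonneg μ u s)
      hi.1.aemeasurable,
    lintegral_eq_lintegral_meas_lt _ (ae_of_all _ hu0) hum.restrict]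
  refine setLIntegral_mono' measurableSet_Ioi fun l hl => ?_
  rw [Measure.restrict_apply' measurableSet_Ioc]
  have h1 : (μ.restrict E) {a | l < u a} ≤ ENNReal.ofReal (min t (μ {x | l < |u x|}).toReal) := by
    rw [ENNReal.ofReal_min, ENNReal.ofReal_toReal (measure_ne_top _ _)]
    refine le_min ?_ ?_
    · exact ((measure_mono (subset_univ _)).trans (by simp)).trans hE
    · refine (Measure.restrict_apply_le _ _).trans (measure_mono fun x hx => ?_)
      have hx : l < u x := hx
      exact lt_of_lt_of_le hx (le_abs_self (u x))
  have h2 : Ioo 0 (min t (μ {x | l < |u x|}).toReal) ⊆ {a | l < decRearr μ u a} ∩ Ioc 0 t := by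
    rintro s ⟨h0, hs⟩
    rw [lt_min_iff] at hs
    refine ⟨?_, h0, hs.1.le⟩
    by_contra hc
    have h3 := (decRearr_le_iff μ hum h0 (le_of_lt hl)).1 (not_lt.1 hc)
    have := ENNReal.toReal_le_of_le_ofReal h0.le h3
    linarith [hs.2]
  refine h1.trans (le_trans (le_of_eq ?_) (measure_mono h2))
  rw [Real.volume_Ioo, sub_zero]

lemma abstract_deriv {u F : ℝ → ℝ} {q K : ℝ} (hK : 0 ≤ K)
    (hu : AntitoneOn u (Ioi 0)) (hF : Monotone F)
    (h : ∀ s₀ s₁, 0 < s₀ → s₀ < s₁ → s₀ ^ q * (u s₀ - u s₁) ≤ K * (F s₁ - F s₀)) {t : ℝ}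
    (ht : 0 < t) :
    (∀ᵐ s ∂(volume.restrict (Ioi (0 : ℝ))), DifferentiableAt ℝ u s) ∧
    ∫ s in Ioc 0 t, s ^ q * (-(deriv u s)) ≤ K * (F t - F 0) := by
  have hd : ∀ᵐ s ∂(volume.restrict (Ioi (0 : ℝ))), DifferentiableAt ℝ u s := by
    have := hu.neg.ae_differentiableWithinAt measurableSet_Ioi
    filter_upwards [this, ae_restrict_mem measurableSet_Ioi] with s hs hs0
    have h2 := (hs.differentiableAt (Ioi_mem_nhds hs0)).neg
    simpa using h2
  refine ⟨hd, ?_⟩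
  have hFd : ∀ᵐ s ∂(volume.restrict (Ioc 0 t)), DifferentiableAt ℝ F s :=
    ae_restrict_of_ae hF.ae_differentiableAt
  have hd' : ∀ᵐ s ∂(volume.restrict (Ioc 0 t)), DifferentiableAt ℝ u s :=
    ae_mono (Measure.restrict_mono Ioc_subset_Ioi_self le_rfl) hd
  have hint := (hF.monotoneOn (uIcc 0 t)).intervalIntegrable_deriv
  have hle := (hF.monotoneOn (uIcc 0 t)).intervalIntegral_deriv_mem_uIcc
  rw [uIcc_of_le (sub_nonneg.2 (hF ht.le))] at hle
  rw [intervalIntegral.integral_of_le ht.le] at hle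
  have key : ∫ s in Ioc 0 t, s ^ q * (-(deriv u s)) ≤ ∫ s in Ioc 0 t, K * deriv F s := by
    refine integral_mono_of_nonneg ?_ ?_ ?_
    · filter_upwards [hd', ae_restrict_mem measurableSet_Ioc] with s hs hs0
      have h1 : 0 < s := hs0.1
      have h2 : deriv u s ≤ 0 := by
        have h3 := hs.hasDerivAt.tendsto_slope_zero_right
        refine le_of_tendsto h3 ?_
        filter_upwards [self_mem_nhdsWithin] with x hx
        have hx : 0 < x := hx
        have := hu (a := s) (b := s + x) h1 (by simp; linarith) (by linarith)
        rw [smul_eq_mul]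
        exact mul_nonpos_of_nonneg_of_nonpos (by positivity) (by linarith)
      exact mul_nonneg (Real.rpow_nonneg h1.le _) (by linarith)
    · exact (((intervalIntegrable_iff_integrableOn_Ioc_of_le ht.le).1 hint)).const_mul K
    · filter_upwards [hd', hFd, ae_restrict_mem measurableSet_Ioc] with s hs hsF hs0
      have h1 : 0 < s := hs0.1
      have h3 := hs.hasDerivAt.tendsto_slope_zero_right
      have h4 := hsF.hasDerivAt.tendsto_slope_zero_right
      have h5 := (h3.neg).const_mul (s ^ q)
      refine le_of_tendsto_of_tendsto h5 (h4.const_mul K) ?_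
      filter_upwards [self_mem_nhdsWithin] with x hx
      have hx : 0 < x := hx
      have h6 := h s (s + x) h1 (by linarith)
      have h7 := mul_le_mul_of_nonneg_left h6 (inv_nonneg.2 hx.le)
      simp only [smul_eq_mul]
      nlinarith
  refine key.trans ?_
  rw [integral_const_mul]
  exact mul_le_mul_of_nonneg_left hle.2 hK

/-- odd truncation -/
def trunc (a b y : ℝ) : ℝ := max (-b) (min b y) - max (-a) (min a y)

lemma trunc_lip (a b : ℝ) : LipschitzWith 2 (trunc a b) := by
  have h : ∀ c : ℝ, LipschitzWith 1 fun y : ℝ => max (-c) (min c y) := fun c =>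
    (LipschitzWith.id.const_min c).const_max (-c)
  have := (h b).sub (h a)
  norm_num at this
  exact this

lemma trunc_abs_le {a b : ℝ} (ha : 0 < a) (hab : a < b) (y : ℝ) : |trunc a b y| ≤ b - a := by
  unfold trunc
  rw [abs_le]
  constructor <;> grind

lemma trunc_eq_of_ge {a b y : ℝ} (ha : 0 < a) (hab : a < b) (h : b ≤ |y|) :
    |trunc a b y| = b - a := by
  unfold trunc
  rcases le_total 0 y with h0 | h0
  · rw [abs_of_nonneg h0] at h
    rw [min_eq_left h, min_eq_left (by linarith), max_eq_right (by linarith),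
      max_eq_right (by linarith), abs_of_nonneg (by linarith)]
  · rw [abs_of_nonpos h0] at h
    rw [min_eq_right (by linarith), min_eq_right (by linarith), max_eq_left (by linarith),
      max_eq_left (by linarith), abs_of_nonpos (by linarith)]
    ring

lemma trunc_nonneg {a b y : ℝ} (ha : 0 < a) (hab : a < b) (h : 0 ≤ y) : 0 ≤ trunc a b y := by
  unfold trunc; grind

lemma trunc_nonpos {a b y : ℝ} (ha : 0 < a) (hab : a < b) (h : y ≤ 0) : trunc a b y ≤ 0 := by
  unfold trunc; grind

lemma memW_trunc {n : ℕ} {Ω : Set (Euc n)} (hO : IsOpen Ω) (hv : volume Ω = 1)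
    {f : Euc n → ℝ} (hf : MemW Ω f) (r : ℝ) {a b : ℝ} (ha : 0 < a) (hab : a < b) :
    MemW Ω (fun x => trunc a b (f x - r)) ∧
    ∫ x in Ω, gradNorm (fun x => trunc a b (f x - r)) x =
      ∫ x in Ω ∩ {x | a < |f x - r| ∧ |f x - r| < b}, gradNorm f x := by
  obtain ⟨hl, hi, hg⟩ := hf
  have hcont : ContinuousOn f Ω := by
    intro x hx
    obtain ⟨s, hs, K, hK⟩ := hl x hx
    exact ((hK.continuousOn x (mem_of_mem_nhds hs)).continuousAt hs).continuousWithinAt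
  have hlip : ∀ x ∈ Ω, ∃ s ∈ nhds x, ∃ K : ℝ≥0,
      LipschitzOnWith K (fun x => trunc a b (f x - r)) s := by
    intro x hx
    obtain ⟨s, hs, K, hK⟩ := hl x hx
    refine ⟨s, hs, 2 * (K + 0), ?_⟩
    exact (trunc_lip a b).comp_lipschitzOnWith (hK.sub (LipschitzWith.const r).lipschitzOnWith)
  have hcont2 : ContinuousOn (fun x => trunc a b (f x - r)) Ω :=
    (trunc_lip a b).continuous.comp_continuousOn (hcont.sub continuousOn_const)
  have hopen : IsOpen (Ω ∩ {x | a < |f x - r| ∧ |f x - r| < b}) := by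
    have : ContinuousOn (fun x => |f x - r|) Ω := (hcont.sub continuousOn_const).abs
    exact this.isOpen_inter_preimage hO (isOpen_Ioo (a := a) (b := b))
  have hgrad : ∀ x ∈ Ω, gradNorm (fun x => trunc a b (f x - r)) x =
      (Ω ∩ {x | a < |f x - r| ∧ |f x - r| < b}).indicator (gradNorm f) x := by
    intro x hx
    have hca : ContinuousAt (fun x => f x - r) x :=
      ((hcont x hx).continuousAt (hO.mem_nhds hx)).sub continuousAt_const
    by_cases hxm : a < |f x - r| ∧ |f x - r| < b
    · rw [indicator_of_mem (show x ∈ Ω ∩ {x | a < |f x - r| ∧ |f x - r| < b} from ⟨hx, hxm⟩)]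
      unfold gradNorm
      have : ∃ c : ℝ, (fun x => trunc a b (f x - r)) =ᶠ[𝓝 x] fun x => f x - c := by
        rcases le_total 0 (f x - r) with h0 | h0
        · rw [abs_of_nonneg h0] at hxm
          refine ⟨r + a, ?_⟩
          filter_upwards [hca.eventually (Ioo_mem_nhds hxm.1 hxm.2)] with y hy
          have := hy.1
          have := hy.2
          unfold trunc
          grind
        · rw [abs_of_nonpos h0] at hxm
          refine ⟨r - a, ?_⟩
          filter_upwards [hca.eventually (Ioo_mem_nhds (a := -b) (b := -a) (by linarith)
            (by linarith))] with y hy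
          have := hy.1
          have := hy.2
          unfold trunc
          grind
      obtain ⟨c, hc⟩ := this
      rw [hc.fderiv_eq, fderiv_sub_const]
    · rw [indicator_of_notMem (fun h => hxm h.2)]
      unfold gradNorm
      have : IsLocalExtr (fun x => trunc a b (f x - r)) x := by
        rcases le_or_gt b (|f x - r|) with h1 | h1
        · rcases le_total 0 (f x - r) with h0 | h0
          · rw [abs_of_nonneg h0] at h1
            right
            refine Eventually.of_forall fun y => ?_
            unfold trunc
            grind
          · rw [abs_of_nonpos h0] at h1
            left
            refine Eventually.of_forall fun y => ?_
            unfold trunc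
            grind
        · have h2 : |f x - r| ≤ a := by
            by_contra! h
            exact hxm ⟨h, h1⟩
          rcases le_total 0 (f x - r) with h0 | h0
          · rw [abs_of_nonneg h0] at h2
            left
            filter_upwards [hca.eventually (Ioi_mem_nhds (a := -a) (by linarith))] with y hy
            have : -a < f y - r := hy
            unfold trunc
            grind
          · rw [abs_of_nonpos h0] at h2
            right
            filter_upwards [hca.eventually (Iio_mem_nhds (show f x - r < a by linarith))] with y hy
            have : f y - r < a := hy
            unfold trunc
            grind
      rw [this.fderiv_eq_zero, norm_zero]
  refine ⟨⟨hlip, ?_, ?_⟩, ?_⟩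
  · refine IntegrableOn.of_bound (C := b - a) (by rw [hv]; exact ENNReal.one_lt_top)
      (hcont2.aestronglyMeasurable hO.measurableSet) (ae_of_all _ fun x => trunc_abs_le ha hab _)
  · rw [integrableOn_congr_fun hgrad hO.measurableSet]
    exact hg.indicator hopen.measurableSet
  · rw [setIntegral_congr_fun hO.measurableSet hgrad, setIntegral_indicator hopen.measurableSet]
    congr 2
    ext x
    simp

lemma trunc_ineq {n : ℕ} {Ω : Set (Euc n)} (hO : IsOpen Ω) (hv : volume Ω = 1)
    {p C₀ : ℝ} (hp : 1 ≤ p) (hSP : SPIneq Ω p C₀)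
    {f : Euc n → ℝ} (hf : MemW Ω f) {r : ℝ} (hr : IsMedian Ω f r) {a b : ℝ} (ha : 0 < a)
    (hab : a < b) {s : ℝ} (hs : 0 ≤ s)
    (hsb : ENNReal.ofReal s ≤ (volume.restrict Ω) {x | b ≤ |f x - r|}) :
    s ^ (1 / p) * (b - a) ≤
      4 * C₀ * ∫ x in Ω ∩ {x | a < |f x - r| ∧ |f x - r| < b}, gradNorm f x := by
  obtain ⟨hW, hgr⟩ := memW_trunc hO hv hf r ha hab
  have hSP1 := hSP _ hW
  rw [hgr] at hSP1
  set h : Euc n → ℝ := fun x => trunc a b (f x - r) with hh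
  set m := ∫ y in Ω, h y with hm
  have hc : 0 < b - a := by linarith
  have hp0 : 0 < p := by linarith
  have : IsFiniteMeasure (volume.restrict Ω) := ⟨by simp [hv]⟩
  have hint : Integrable (fun x => |h x - m| ^ p) (volume.restrict Ω) := by
    refine Integrable.of_bound (C := ((b - a) + |m|) ^ p) ?_ (ae_of_all _ fun x => ?_)
    · have h1 := hW.2.1.1.aemeasurable
      have h2 : AEMeasurable (fun x => |h x - m| ^ p) (volume.restrict Ω) := by fun_prop
      exact h2.aestronglyMeasurable
    · rw [Real.norm_of_nonneg (by positivity)]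
      refine Real.rpow_le_rpow (abs_nonneg _) ?_ hp0.le
      exact (abs_sub _ _).trans (add_le_add_left (trunc_abs_le ha hab _) _)
  have hmeas : s / 2 ≤ (volume.restrict Ω).real {x | ((b - a) / 2) ^ p ≤ |h x - m| ^ p} := by
    have hset : {x | ((b - a) / 2) ^ p ≤ |h x - m| ^ p} = {x | (b - a) / 2 ≤ |h x - m|} := by
      ext x
      simp only [mem_ofPred_eq]
      exact Real.rpow_le_rpow_iff (by positivity) (abs_nonneg _) hp0
    rw [hset, measureReal_def]
    have hsplit : ENNReal.ofReal (s / 2) ≤ (volume.restrict Ω) {x | (b - a) / 2 ≤ |h x - m|} := by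
      have hs1 : s ≤ 1 := by
        have : ENNReal.ofReal s ≤ 1 := hsb.trans ((measure_mono (subset_univ _)).trans (by simp [hv]))
        simpa using this
      have hs2 : ENNReal.ofReal (s / 2) ≤ 1 / 2 := by
        rw [ENNReal.ofReal_div_of_pos (by norm_num)]
        have : ENNReal.ofReal s ≤ 1 := by simpa using hs1
        rw [show ENNReal.ofReal 2 = 2 by simp]
        gcongr
      rcases le_or_gt ((b - a) / 2) |m| with h1 | h1
      · refine hs2.trans ?_
        rw [Measure.restrict_apply' hO.measurableSet]
        rcases le_total 0 m with h0 | h0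
        · refine hr.2.trans (measure_mono fun x hx => ⟨?_, hx.1⟩)
          have h2 : f x ≤ r := hx.2
          have h3 : h x ≤ 0 := trunc_nonpos ha hab (by linarith)
          change (b - a) / 2 ≤ |h x - m|
          rw [abs_of_nonneg h0] at h1
          rw [abs_of_nonpos (by linarith)]
          linarith
        · refine hr.1.trans (measure_mono fun x hx => ⟨?_, hx.1⟩)
          have h2 : r ≤ f x := hx.2
          have h3 : 0 ≤ h x := trunc_nonneg ha hab (by linarith)
          change (b - a) / 2 ≤ |h x - m|
          rw [abs_of_nonpos h0] at h1
          rw [abs_of_nonneg (by linarith)]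
          linarith
      · refine (ENNReal.ofReal_le_ofReal (by linarith : s / 2 ≤ s)).trans (hsb.trans
          (measure_mono fun x hx => ?_))
        have hx : b ≤ |f x - r| := hx
        change (b - a) / 2 ≤ |h x - m|
        have h3 : |h x| = b - a := trunc_eq_of_ge ha hab hx
        have := abs_sub_abs_le_abs_sub (h x) m
        linarith
    exact (ENNReal.ofReal_le_iff_le_toReal (measure_ne_top _ _)).1 hsplit
  have hcheb := mul_meas_ge_le_integral_of_nonneg
    (ae_of_all _ fun x => Real.rpow_nonneg (abs_nonneg (h x - m)) p) hint (((b - a) / 2) ^ p)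
  have h1 : ((b - a) / 2) ^ p * (s / 2) ≤ ∫ x in Ω, |h x - m| ^ p :=
    (mul_le_mul_of_nonneg_left hmeas (by positivity)).trans hcheb
  have h2 := (Real.rpow_le_rpow (by positivity) h1 (by positivity : 0 ≤ 1 / p)).trans hSP1
  rw [Real.mul_rpow (by positivity) (by positivity), ← Real.rpow_mul (by positivity),
    mul_one_div_cancel hp0.ne', Real.rpow_one, Real.div_rpow hs (by norm_num)] at h2
  have h3 : (2 : ℝ) ^ (1 / p) ≤ 2 := by
    have : 1 / p ≤ 1 := by rw [div_le_one hp0]; exact hp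
    simpa using Real.rpow_le_rpow_of_exponent_le (by norm_num : (1 : ℝ) ≤ 2) this
  have h4 : s ^ (1 / p) / 2 ≤ s ^ (1 / p) / 2 ^ (1 / p) := by gcongr
  have h5 := (mul_le_mul_of_nonneg_left h4 (by linarith : 0 ≤ (b - a) / 2)).trans h2
  linarith
/-- If `Ω` satisfies the `p`-Sobolev–Poincaré inequality with constant `C₀`
(`1 ≤ p ≤ n/(n−1)`), then there is `C = C(p, C₀)` such that for every
`f ∈ W(Ω)` and every median `r` of `f`, the nonincreasing function `(f − r)*` is
differentiable a.e. on `(0,1)` and for every `t ∈ (0,1)`: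
`∫₀ᵗ s^{1/p} (−((f − r)*)'(s)) ds ≤ C ∫₀ᵗ |∇f|*(s) ds`. -/
theorem stmt2 (p C₀ : ℝ) (hp : 1 ≤ p) (hC₀ : 0 < C₀) :
    ∃ C : ℝ, 0 < C ∧ ∀ n : ℕ, 2 ≤ n → ∀ Ω : Set (Euc n),
      IsOpen Ω → IsConnected Ω → volume Ω = 1 → p ≤ (n : ℝ) / ((n : ℝ) - 1) →
      SPIneq Ω p C₀ →
      ∀ f : Euc n → ℝ, MemW Ω f → ∀ r : ℝ, IsMedian Ω f r →
        (∀ᵐ s ∂(volume.restrict (Ioo (0 : ℝ) 1)),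
            DifferentiableAt ℝ (decRearr (volume.restrict Ω) (fun x => f x - r)) s) ∧
        ∀ t ∈ Ioo (0 : ℝ) 1,
          (∫ s in Ioc (0 : ℝ) t,
              s ^ (1 / p) * (-(deriv (decRearr (volume.restrict Ω) (fun x => f x - r)) s)))
            ≤ C * ∫ s in Ioc (0 : ℝ) t, decRearr (volume.restrict Ω) (gradNorm f) s := by

  refine ⟨4 * C₀, by positivity, ?_⟩
  intro n _ Ω hO _ hv _ hSP f hf r hr
  have : IsFiniteMeasure (volume.restrict Ω) := ⟨by simp [hv]⟩
  have hgi : Integrable (gradNorm f) (volume.restrict Ω) := hf.2.2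
  have hgm : AEMeasurable (fun x => f x - r) (volume.restrict Ω) :=
    hf.2.1.1.aemeasurable.sub aemeasurable_const
  have hgn : ∀ x, 0 ≤ gradNorm f x := fun x => norm_nonneg _
  have hnull : ∀ l : ℝ, NullMeasurableSet {x | l < |f x - r|} (volume.restrict Ω) := fun l =>
    nullMeasurableSet_lt aemeasurable_const (hgm.abs)
  set u := decRearr (volume.restrict Ω) (fun x => f x - r) with hu
  have hanti : AntitoneOn u (Ioi 0) := decRearr_anti _ hgm
  set F : ℝ → ℝ := fun s => if s ≤ 0 then 0 else ∫ x in {x | u s < |f x - r|}, gradNorm f x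
    ∂(volume.restrict Ω) with hF
  have hFpos : ∀ s, 0 < s → F s = ∫ x in {x | u s < |f x - r|}, gradNorm f x
    ∂(volume.restrict Ω) := fun s hs => by simp [hF, not_le.2 hs]
  have hFmono : Monotone F := by
    intro s t hst
    rcases le_or_gt s 0 with hs | hs
    · have h1 : F s = 0 := by simp [hF, hs]
      rw [h1]
      simp only [hF]
      split_ifs
      · exact le_rfl
      · exact integral_nonneg hgn
    · rw [hFpos s hs, hFpos t (hs.trans_le hst)]
      refine setIntegral_mono_set hgi.integrableOn (ae_of_all _ hgn) (LE.le.eventuallyLE ?_)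
      intro x hx
      exact lt_of_le_of_lt (hanti hs (hs.trans_le hst) hst) hx
  have hkey : ∀ s₀ s₁, 0 < s₀ → s₀ < s₁ →
      s₀ ^ (1 / p) * (u s₀ - u s₁) ≤ (4 * C₀) * (F s₁ - F s₀) := by
    intro s₀ s₁ h0 h01
    have hle : u s₁ ≤ u s₀ := hanti h0 (h0.trans h01) h01.le
    have hu1 : 0 ≤ u s₁ := decRearr_nonneg _ _ _
    rcases hle.eq_or_lt with heq | hlt
    · rw [heq, sub_self, mul_zero]
      exact mul_nonneg (by positivity) (sub_nonneg.2 (hFmono h01.le))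
    have hstep : ∀ a ∈ Ioo (u s₁) (u s₀),
        s₀ ^ (1 / p) * (u s₀ - a) ≤ (4 * C₀) * (F s₁ - F s₀) := by
      intro a ha
      have h1 := trunc_ineq hO hv hp hSP hf hr (lt_of_le_of_lt hu1 ha.1) ha.2 h0.le
        (meas_ge_decRearr _ hgm h0 (lt_of_le_of_lt hu1 hlt))
      refine h1.trans (mul_le_mul_of_nonneg_left ?_ (by positivity))
      rw [hFpos s₀ h0, hFpos s₁ (h0.trans h01)]
      have hsub : {x | u s₀ < |f x - r|} ⊆ {x | u s₁ < |f x - r|} :=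
        fun x hx => lt_of_le_of_lt hle hx
      rw [← setIntegral_sdiff₀ (hnull _) hgi.integrableOn hsub]
      rw [inter_comm, ← Measure.restrict_restrict' hO.measurableSet]
      refine setIntegral_mono_set hgi.integrableOn (ae_of_all _ hgn)
        (LE.le.eventuallyLE ?_)
      rintro x ⟨hx1, hx2⟩
      exact ⟨ha.1.trans hx1, fun h => lt_asymm h hx2⟩
    have htend : Tendsto (fun a => s₀ ^ (1 / p) * (u s₀ - a)) (𝓝[>] (u s₁))
        (𝓝 (s₀ ^ (1 / p) * (u s₀ - u s₁))) := by
      have : Continuous fun a => s₀ ^ (1 / p) * (u s₀ - a) := by fun_prop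
      exact (this.tendsto _).mono_left nhdsWithin_le_nhds
    exact le_of_tendsto htend (by
      filter_upwards [Ioo_mem_nhdsGT hlt] with a ha using hstep a ha)
  have habs := fun t ht => abstract_deriv (t := t) (by positivity : 0 ≤ 4 * C₀) hanti hFmono hkey ht
  refine ⟨?_, ?_⟩
  · exact ae_mono (Measure.restrict_mono Ioo_subset_Ioi_self le_rfl) (habs 1 one_pos).1
  · intro t ht
    refine (habs t ht.1).2.trans (mul_le_mul_of_nonneg_left ?_ (by positivity))
    have hF0 : F 0 = 0 := by simp [hF]
    rw [hF0, sub_zero, hFpos t ht.1]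
    exact hardy_littlewood _ hgi hgn (meas_gt_decRearr _ hgm ht.1)
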